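/- Let z ∈ ℂ and suppose there exists μ > 0 such that |z| ≤ μ/Ψ(μ). Then for every measurable set Λ ⊆ ℝ^d of finite Lebesgue measure |Λ|, the finite-volume cluster expansion converges absolutely, with Σ_{n≥1} (|z|^n/n!) ∫_{Λ^n} |ω^T_n(x_1,…,x_n)| dx_1⋯dx_n ≤ μ·|Λ|; consequently the series Σ_{n≥1} (z^n/n!) ∫_{Λ^n} ω^T_n(x_1,…,x_n) dx_1⋯dx_n converges and its modulus is at most μ·|Λ|. -/

import Mathlib

open MeasureTheory ENNReal
open scoped Classical

noncomputable section

/-- Pair weight `w(x,y) = exp(-β φ(x-y))`, with `exp(-(+∞)) = 0`. -/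
def pairW {d : ℕ} (β : ℝ) (φ : (Fin d → ℝ) → ℝ≥0∞) (x y : Fin d → ℝ) : ℝ :=
  if φ (x - y) = ∞ then 0 else Real.exp (-(β * (φ (x - y)).toReal))

/-- Truncated weight `ω^T_n`: sum over connected graphs on `{1,…,n}`. -/
def omegaT {S : Type*} (w : S → S → ℝ) (n : ℕ) (x : Fin n → S) : ℝ :=
  ∑ G : SimpleGraph (Fin n),
    if G.Connected then
      ∏ p ∈ Finset.univ.filter (fun p : Fin n × Fin n => p.1 < p.2 ∧ G.Adj p.1 p.2),
        (w (x p.1) (x p.2) - 1)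
    else 0

/-- `φ_n(x; x_1,…,x_n) = Π_i (1 - w(x,x_i)) Π_{i<j} w(x_i,x_j)`. -/
def phiVertex {S : Type*} (w : S → S → ℝ) (n : ℕ) (x : S) (y : Fin n → S) : ℝ :=
  (∏ i, (1 - w x (y i))) *
    ∏ p ∈ Finset.univ.filter (fun p : Fin n × Fin n => p.1 < p.2), w (y p.1) (y p.2)

/-- `g(n) = ∫_{ℝ^{dn}} φ_n(0; x_1,…,x_n) dx`. -/
def gCoef {d : ℕ} (β : ℝ) (φ : (Fin d → ℝ) → ℝ≥0∞) (n : ℕ) : ℝ≥0∞ :=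
  ∫⁻ y : Fin n → Fin d → ℝ, ENNReal.ofReal (phiVertex (pairW β φ) n 0 y)

/-- The vertex sum `Ψ(t) = 1 + Σ_{n≥1} g(n) t^n/n!` (extended to `t ∈ [0,∞]`). -/
def vertexSum {d : ℕ} (β : ℝ) (φ : (Fin d → ℝ) → ℝ≥0∞) (t : ℝ≥0∞) : ℝ≥0∞ :=
  1 + ∑' n : ℕ, gCoef β φ (n + 1) * t ^ (n + 1) / ((n + 1).factorial : ℝ≥0∞)


section Combinatorics

variable {ι : Type*} [DecidableEq ι]

/-- The unordered pairs of distinct elements of `U`. -/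
def pairEdges (U : Finset ι) : Finset (Sym2 ι) := U.sym2.filter fun e => ¬ e.IsDiag

/-- Every element of `X` is joined to some element of `Y` by a path with edges in `E`. -/
def RootedAt (E : Finset (Sym2 ι)) (Y X : Finset ι) : Prop :=
  ∀ x ∈ X, ∃ y ∈ Y, Relation.ReflTransGen (fun a b => s(a, b) ∈ E) y x

/-- The weighted sum over graphs on `Y ∪ X` in which every vertex of `X` is joined to `Y`. -/
def rootedSum (F : Sym2 ι → ℝ) (Y X : Finset ι) : ℝ :=
  ∑ E ∈ (pairEdges (Y ∪ X)).powerset, if RootedAt E Y X then ∏ e ∈ E, F e else 0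

theorem mk_mem_pairEdges {U : Finset ι} {a b : ι} :
    s(a, b) ∈ pairEdges U ↔ a ∈ U ∧ b ∈ U ∧ a ≠ b := by
  simp [pairEdges, and_assoc]

theorem rootedAt_union_star {E : Finset (Sym2 ι)} {Y X T S : Finset ι} {v : ι}
    (hE : E ⊆ pairEdges (Y ∪ X)) (hT : T ⊆ Y) (hvY : v ∉ Y) (hvX : v ∉ X) :
    RootedAt (E ∪ (T ∪ S).image fun u => s(v, u)) (insert v Y) X ↔
      RootedAt E (Y ∪ S) (X \ S) := by
  have key : ∀ y ∈ insert v Y, ∀ x,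
      Relation.ReflTransGen
        (fun a b => s(a, b) ∈ E ∪ (T ∪ S).image fun u => s(v, u)) y x → x ≠ v →
      ∃ y' ∈ Y ∪ S, Relation.ReflTransGen (fun a b => s(a, b) ∈ E) y' x := by
    intro y hy x hyx
    induction hyx with
    | refl =>
      intro hne
      exact ⟨y, Finset.mem_union_left _ ((Finset.mem_insert.1 hy).resolve_left hne), .refl⟩
    | @tail b c _ hbc ih =>
      intro hne
      by_cases hb : b = v
      · subst hb
        rcases Finset.mem_union.1 hbc with h | h
        · have := mk_mem_pairEdges.1 (hE h)
          grind
        · obtain ⟨u, hu, h⟩ := Finset.mem_image.1 h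
          have : u = c := by grind [Sym2.eq_iff]
          subst this
          exact ⟨u, by grind, .refl⟩
      · obtain ⟨y', hy', hr⟩ := ih hb
        refine ⟨y', hy', hr.tail ?_⟩
        rcases Finset.mem_union.1 hbc with h | h
        · exact h
        · obtain ⟨u, hu, h⟩ := Finset.mem_image.1 h
          grind [Sym2.eq_iff]
  constructor
  · intro h x hx
    have hxX := (Finset.mem_sdiff.1 hx).1
    obtain ⟨y, hy, hr⟩ := h x hxX
    exact key y hy x hr (fun hxv => hvX (hxv ▸ hxX))
  · intro h x hx
    have hstar : ∀ u ∈ S, s(v, u) ∈ E ∪ (T ∪ S).image fun u => s(v, u) := fun u hu =>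
      Finset.mem_union_right _
        (Finset.mem_image_of_mem _ (Finset.mem_union_right _ hu))
    by_cases hxS : x ∈ S
    · exact ⟨v, Finset.mem_insert_self _ _, .single (hstar x hxS)⟩
    · obtain ⟨y, hy, hr⟩ := h x (Finset.mem_sdiff.2 ⟨hx, hxS⟩)
      have hr' : Relation.ReflTransGen
          (fun a b => s(a, b) ∈ E ∪ (T ∪ S).image fun u => s(v, u)) y x :=
        Relation.ReflTransGen.mono (fun a b hab => Finset.mem_union_left _ hab) _ _ hr
      rcases Finset.mem_union.1 hy with hy | hy
      · exact ⟨y, Finset.mem_insert_of_mem hy, hr'⟩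
      · exact ⟨v, Finset.mem_insert_self _ _, hr'.head (hstar y hy)⟩

/-- Graph form of the Kirkwood-Salsburg recursion: delete the root `v`, whose neighbours in `X`
become roots. -/
theorem rootedSum_insert (F : Sym2 ι → ℝ) {Y X : Finset ι} {v : ι}
    (hvY : v ∉ Y) (hvX : v ∉ X) (hYX : Disjoint Y X) :
    rootedSum F (insert v Y) X = (∏ y ∈ Y, (1 + F s(v, y))) *
      ∑ S ∈ X.powerset, (∏ s ∈ S, F s(v, s)) * rootedSum F (Y ∪ S) (X \ S) := by
  have hexp : (∏ y ∈ Y, (1 + F s(v, y))) *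
      ∑ S ∈ X.powerset, (∏ s ∈ S, F s(v, s)) * rootedSum F (Y ∪ S) (X \ S) =
      ∑ q ∈ Y.powerset ×ˢ X.powerset ×ˢ (pairEdges (Y ∪ X)).powerset,
        (∏ t ∈ q.1, F s(v, t)) * ((∏ s ∈ q.2.1, F s(v, s)) *
          if RootedAt q.2.2 (Y ∪ q.2.1) (X \ q.2.1) then ∏ e ∈ q.2.2, F e else 0) := by
    rw [Finset.prod_one_add, Finset.sum_mul_sum, Finset.sum_product]
    refine Finset.sum_congr rfl fun T _ => ?_
    rw [Finset.sum_product]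
    refine Finset.sum_congr rfl fun S hS => ?_
    have : Y ∪ S ∪ X \ S = Y ∪ X := by grind
    rw [rootedSum, this, Finset.mul_sum, Finset.mul_sum]
  rw [hexp, rootedSum]
  symm
  refine Finset.sum_nbij'
    (fun q => q.2.2 ∪ (q.1 ∪ q.2.1).image fun u => s(v, u))
    (fun E => (Y.filter fun u => s(v, u) ∈ E, X.filter fun u => s(v, u) ∈ E,
      E.filter fun e => v ∉ e)) ?_ ?_ ?_ ?_ ?_
  · rintro ⟨T, S, E⟩ hq
    simp only [Finset.mem_product, Finset.mem_powerset] at hq ⊢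
    obtain ⟨hT, hS, hE⟩ := hq
    intro e he
    induction e with | _ a b => ?_
    rw [mk_mem_pairEdges]
    rcases Finset.mem_union.1 he with h | h
    · have := mk_mem_pairEdges.1 (hE h)
      grind
    · obtain ⟨u, hu, h⟩ := Finset.mem_image.1 h
      grind [Sym2.eq_iff]
  · intro E hE
    simp only [Finset.mem_product, Finset.mem_powerset] at hE ⊢
    refine ⟨Finset.filter_subset _ _, Finset.filter_subset _ _, ?_⟩
    intro e he
    induction e with | _ a b => ?_
    have h1 := Finset.mem_filter.1 he
    have := mk_mem_pairEdges.1 (hE h1.1)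
    rw [mk_mem_pairEdges]
    grind
  · rintro ⟨T, S, E⟩ hq
    simp only [Finset.mem_product, Finset.mem_powerset] at hq
    obtain ⟨hT, hS, hE⟩ := hq
    have hEv : ∀ e ∈ E, v ∉ e := by
      intro e he
      induction e with | _ a b => ?_
      have := mk_mem_pairEdges.1 (hE he)
      grind
    have hst : ∀ u, s(v, u) ∈ E ∪ (T ∪ S).image (fun u => s(v, u)) ↔ u ∈ T ∪ S := by
      intro u
      constructor
      · intro h
        rcases Finset.mem_union.1 h with h | h
        · exact absurd (Sym2.mem_mk_left v u) (hEv _ h)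
        · obtain ⟨u', hu, h⟩ := Finset.mem_image.1 h
          grind [Sym2.eq_iff]
      · exact fun h => Finset.mem_union_right _ (Finset.mem_image_of_mem _ h)
    rw [Finset.disjoint_left] at hYX
    simp only [hst, Prod.mk.injEq]
    refine ⟨by grind, by grind, ?_⟩
    ext e
    simp only [Finset.mem_filter, Finset.mem_union, Finset.mem_image]
    constructor
    · rintro ⟨h | ⟨u, _, rfl⟩, h2⟩
      · exact h
      · exact absurd (Sym2.mem_mk_left v u) h2
    · exact fun h => ⟨Or.inl h, hEv e h⟩
  · intro E hE
    rw [Finset.mem_powerset] at hE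
    ext e
    simp only [Finset.mem_filter, Finset.mem_union, Finset.mem_image]
    constructor
    · rintro (h | ⟨u, h | h, rfl⟩)
      exacts [h.1, h.2, h.2]
    · intro he
      by_cases hve : v ∈ e
      · obtain ⟨u, rfl⟩ := hve
        have := mk_mem_pairEdges.1 (hE he)
        right
        refine ⟨u, ?_, rfl⟩
        grind
      · exact Or.inl ⟨he, hve⟩
  · rintro ⟨T, S, E⟩ hq
    simp only [Finset.mem_product, Finset.mem_powerset] at hq
    obtain ⟨hT, hS, hE⟩ := hq
    have hEv : ∀ e ∈ E, v ∉ e := by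
      intro e he
      induction e with | _ a b => ?_
      have := mk_mem_pairEdges.1 (hE he)
      grind
    simp only [rootedAt_union_star hE hT hvY hvX]
    split_ifs with h
    · rw [Finset.prod_union, Finset.prod_image, Finset.prod_union]
      · ring
      · exact Finset.disjoint_of_subset_left hT (Finset.disjoint_of_subset_right hS hYX)
      · intro a _ b _ hab
        grind [Sym2.eq_iff]
      · rw [Finset.disjoint_left]
        intro e he h
        obtain ⟨u, _, rfl⟩ := Finset.mem_image.1 h
        exact hEv _ he (Sym2.mem_mk_left v u)
    · simp

theorem rootedSum_empty_left (F : Sym2 ι → ℝ) (X : Finset ι) :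
    rootedSum F ∅ X = if X = ∅ then 1 else 0 := by
  split_ifs with h
  · subst h
    simp [rootedSum, pairEdges, RootedAt]
  · obtain ⟨x, hx⟩ := Finset.nonempty_iff_ne_empty.2 h
    refine Finset.sum_eq_zero fun E _ => if_neg fun hR => ?_
    obtain ⟨y, hy, _⟩ := hR x hx
    simp at hy

theorem rootedSum_image {κ : Type*} [DecidableEq κ] (e : κ → ι) (he : Function.Injective e)
    (F : Sym2 ι → ℝ) (Y X : Finset κ) (hYX : Disjoint Y X) :
    rootedSum F (Y.image e) (X.image e) = rootedSum (fun p => F (p.map e)) Y X := by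
  induction hn : Y.card + X.card generalizing Y X with
  | zero =>
    have hY : Y = ∅ := by rw [← Finset.card_eq_zero]; omega
    subst hY
    simp [rootedSum_empty_left]
  | succ n ih =>
    obtain rfl | ⟨v, hv⟩ := Y.eq_empty_or_nonempty
    · simp [rootedSum_empty_left]
    · obtain ⟨Y, hvY, rfl⟩ : ∃ Y', v ∉ Y' ∧ insert v Y' = Y :=
        ⟨Y.erase v, Finset.notMem_erase _ _, Finset.insert_erase hv⟩
      rw [Finset.disjoint_insert_left] at hYX
      rw [Finset.card_insert_of_notMem hvY] at hn
      rw [rootedSum_insert _ hvY hYX.1 hYX.2, Finset.image_insert,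
        rootedSum_insert _ (by simpa [he.eq_iff] using hvY) (by simpa [he.eq_iff] using hYX.1)
          ((Finset.disjoint_image he).2 hYX.2), Finset.prod_image he.injOn,
        Finset.powerset_image, Finset.sum_image (Finset.image_injective he).injOn]
      congr 1
      refine Finset.sum_congr rfl fun S hS => ?_
      rw [Finset.mem_powerset] at hS
      rw [Finset.prod_image he.injOn, ← Finset.image_union, ← Finset.image_sdiff _ _ he,
        ih (Y ∪ S) (X \ S)]
      · rfl
      · rw [Finset.disjoint_left] at hYX ⊢
        grind
      · have h1 := Finset.card_union_of_disjoint (Finset.disjoint_of_subset_right hS hYX.2)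
        have h2 := Finset.card_sdiff_add_card_eq_card hS
        omega

theorem prod_lt_pairs_eq_prod {n : ℕ} (E : Finset (Sym2 (Fin n))) (hE : ∀ e ∈ E, ¬ e.IsDiag)
    (F : Sym2 (Fin n) → ℝ) :
    ∏ p ∈ Finset.univ.filter (fun p : Fin n × Fin n => p.1 < p.2 ∧ s(p.1, p.2) ∈ E),
      F s(p.1, p.2) = ∏ e ∈ E, F e := by
  refine Finset.prod_nbij (fun p => s(p.1, p.2)) ?_ ?_ ?_ ?_
  · intro p hp
    exact (Finset.mem_filter.1 hp).2.2
  · rintro ⟨a, b⟩ hp ⟨a', b'⟩ hq h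
    simp only [Finset.coe_filter, Finset.mem_univ, true_and, Set.mem_ofPred_eq] at hp hq
    grind [Sym2.eq_iff]
  · intro e he
    induction e with | _ a b => ?_
    have hne : a ≠ b := by simpa using hE _ he
    rcases lt_or_gt_of_ne hne with h | h
    · exact ⟨(a, b), by simpa [h] using he, rfl⟩
    · exact ⟨(b, a), by simpa [h, Sym2.eq_swap (a := b)] using he, Sym2.eq_swap⟩
  · intros; rfl

theorem connected_iff_rootedAt {n : ℕ} (G : SimpleGraph (Fin (n + 1))) :
    G.Connected ↔ RootedAt G.edgeFinset {0} (Finset.univ.erase 0) := by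
  have hreach : ∀ a b, Relation.ReflTransGen (fun a b => s(a, b) ∈ G.edgeFinset) a b ↔
      G.Reachable a b := by
    intro a b
    rw [SimpleGraph.reachable_iff_reflTransGen]
    simp
  constructor
  · intro h x _
    exact ⟨0, Finset.mem_singleton_self _, (hreach _ _).2 (h.preconnected 0 x)⟩
  · intro h
    have h0 : ∀ x, G.Reachable 0 x := by
      intro x
      by_cases hx : x = 0
      · rw [hx]
      · obtain ⟨y, hy, hr⟩ := h x (by simpa using hx)
        rw [Finset.mem_singleton] at hy
        subst hy
        exact (hreach _ _).1 hr
    exact ⟨fun a b => (h0 a).symm.trans (h0 b)⟩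

theorem omegaT_eq_rootedSum {S : Type*} (w : S → S → ℝ) (F : Sym2 S → ℝ)
    (hF : ∀ a b, F s(a, b) = w a b - 1) (n : ℕ) (x : Fin (n + 1) → S) :
    omegaT w (n + 1) x =
      rootedSum (fun p => F (p.map x)) {0} (Finset.univ.erase (0 : Fin (n + 1))) := by
  have hu : ({0} : Finset (Fin (n + 1))) ∪ Finset.univ.erase 0 = Finset.univ := by
    ext i; simp
  rw [omegaT, rootedSum, hu]
  refine Finset.sum_nbij' (fun G => G.edgeFinset)
    (fun E => SimpleGraph.fromEdgeSet (E : Set (Sym2 (Fin (n + 1))))) ?_ ?_ ?_ ?_ ?_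
  · intro G _
    rw [Finset.mem_powerset]
    intro e he
    simpa [pairEdges] using G.not_isDiag_of_mem_edgeFinset he
  · simp
  · intro G _
    simp
  · intro E hE
    rw [Finset.mem_powerset] at hE
    ext e
    have hmem : ∀ G : SimpleGraph (Fin (n + 1)), e ∈ G.edgeFinset ↔ e ∈ G.edgeSet := fun G =>
      SimpleGraph.mem_edgeFinset
    rw [hmem, SimpleGraph.edgeSet_fromEdgeSet]
    constructor
    · exact fun h => h.1
    · exact fun h => ⟨h, (Finset.mem_filter.1 (hE h)).2⟩
  · intro G _
    simp only [connected_iff_rootedAt]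
    split_ifs
    · rw [← prod_lt_pairs_eq_prod _ (fun e he => G.not_isDiag_of_mem_edgeFinset he)]
      refine Finset.prod_congr ?_ ?_
      · ext p; simp
      · intro p _
        simp [hF]
    · rfl

end Combinatorics

section Marginals

variable {ι : Type*} [DecidableEq ι] {S : Type*} [MeasurableSpace S]

theorem lmarginal_mul_of_forall_eq (ν : ι → Measure S) (s : Finset ι) (c f : (ι → S) → ℝ≥0∞)
    (hf : Measurable f) (x : ι → S) (hc : ∀ x', (∀ i ∉ s, x' i = x i) → c x' = c x) :
    lmarginal ν s (fun x => c x * f x) x = c x * lmarginal ν s f x := by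
  rw [lmarginal, lmarginal, ← lintegral_const_mul]
  · refine lintegral_congr fun y => ?_
    rw [hc]
    intro i hi
    simp [Function.updateFinset, hi]
  · exact hf.comp measurable_updateFinset

theorem lmarginal_finset_sum {κ : Type*} (ν : ι → Measure S) (s : Finset ι) (T : Finset κ)
    (f : κ → (ι → S) → ℝ≥0∞) (hf : ∀ k, Measurable (f k)) (x : ι → S) :
    lmarginal ν s (fun x => ∑ k ∈ T, f k x) x = ∑ k ∈ T, lmarginal ν s (f k) x :=
  lintegral_finsetSum _ fun k _ => (hf k).comp measurable_updateFinset

theorem lmarginal_image_univ (ν : Measure S) [SigmaFinite ν] {k : ℕ} (e : Fin k → ι)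
    (he : Function.Injective e) (v : ι) (hv : ∀ i, e i ≠ v) (f : S → (Fin k → S) → ℝ≥0∞)
    (hf : ∀ a, Measurable (f a)) (x : ι → S) :
    lmarginal (fun _ => ν) (Finset.univ.image e) (fun x => f (x v) (x ∘ e)) x =
      ∫⁻ y, f (x v) y ∂Measure.pi fun _ => ν := by
  have h := lmarginal_image (μ := fun _ : ι => ν) he Finset.univ (hf (x v)) x
  rw [lintegral_eq_lmarginal_univ (μ := fun _ : Fin k => ν) (x ∘ e)]
  refine Eq.trans ?_ h
  refine lintegral_congr fun y => ?_
  have : Function.updateFinset x (Finset.univ.image e) y v = x v := by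
    simp [Function.updateFinset, hv]
  simp only [this]
  rfl

theorem exists_injective_image_eq (T : Finset ι) :
    ∃ e : Fin T.card → ι, Function.Injective e ∧ Finset.univ.image e = T := by
  refine ⟨fun i => T.equivFin.symm i, fun i j h => by simpa using h, ?_⟩
  ext a
  simp only [Finset.mem_image, Finset.mem_univ, true_and]
  constructor
  · rintro ⟨i, rfl⟩
    exact (T.equivFin.symm i).2
  · exact fun ha => ⟨T.equivFin ⟨a, ha⟩, by simp⟩

end Marginals

section Star

variable {ι : Type*} {S : Type*}

/-- The product of `1 - F` over the edges from `a` to the points labelled by `T`. -/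
def starProd (F : Sym2 S → ℝ) (T : Finset ι) (a : S) (x : ι → S) : ℝ≥0∞ :=
  ∏ t ∈ T, ENNReal.ofReal (1 - F s(a, x t))

variable [MeasurableSpace S]

theorem measurable_edge {F : Sym2 S → ℝ} (hFm : Measurable fun p : S × S => F s(p.1, p.2))
    (e : Sym2 ι) : Measurable fun x : ι → S => F (e.map x) := by
  induction e with | _ a b => ?_
  have h : Measurable fun x : ι → S => (x a, x b) :=
    (measurable_pi_apply a).prodMk (measurable_pi_apply b)
  exact hFm.comp h

theorem measurable_starProd {F : Sym2 S → ℝ} (hFm : Measurable fun p : S × S => F s(p.1, p.2))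
    (T : Finset ι) {a : (ι → S) → S} (ha : Measurable a) :
    Measurable fun x : ι → S => starProd F T (a x) x :=
  Finset.measurable_fun_prod _ fun t _ =>
    (measurable_const.sub (hFm.comp (ha.prodMk (measurable_pi_apply t)))).ennreal_ofReal

end Star

section RootedBound

variable {ι : Type*} [DecidableEq ι] {S : Type*}

/-- The product of `F` over all pairs of points labelled by `Y`. -/
def pairProd (F : Sym2 S → ℝ) (Y : Finset ι) (x : ι → S) : ℝ≥0∞ :=
  ∏ e ∈ pairEdges Y, ENNReal.ofReal (F (e.map x))

/-- The absolute value of the rooted graph sum with edge weights `F - 1`. -/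
def rootedAbs (F : Sym2 S → ℝ) (Y X : Finset ι) (x : ι → S) : ℝ≥0∞ :=
  ENNReal.ofReal |rootedSum (fun p => F (p.map x) - 1) Y X|

theorem pairEdges_image {κ : Type*} [DecidableEq κ] (e : κ → ι) (he : Function.Injective e)
    (U : Finset κ) : pairEdges (U.image e) = (pairEdges U).image (Sym2.map e) := by
  ext p
  induction p with | _ a b => ?_
  rw [mk_mem_pairEdges]
  constructor
  · rintro ⟨ha, hb, hab⟩
    obtain ⟨a', ha', rfl⟩ := Finset.mem_image.1 ha
    obtain ⟨b', hb', rfl⟩ := Finset.mem_image.1 hb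
    exact Finset.mem_image.2
      ⟨s(a', b'), mk_mem_pairEdges.2 ⟨ha', hb', fun h => hab (congrArg e h)⟩, rfl⟩
  · intro h
    obtain ⟨q, hq, h⟩ := Finset.mem_image.1 h
    induction q with | _ a' b' => ?_
    have := mk_mem_pairEdges.1 hq
    rw [Sym2.map_mk, Sym2.eq_iff] at h
    have := he.ne this.2.2
    grind

theorem pairProd_image {κ : Type*} [DecidableEq κ] (F : Sym2 S → ℝ) (e : κ → ι)
    (he : Function.Injective e) (U : Finset κ) (x : ι → S) :
    pairProd F (U.image e) x = pairProd F U (x ∘ e) := by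
  rw [pairProd, pairEdges_image e he, Finset.prod_image (Sym2.map.injective he).injOn]
  simp [pairProd, Sym2.map_map]

theorem pairProd_insert (F : Sym2 S → ℝ) {Y : Finset ι} {v : ι} (hv : v ∉ Y) (x : ι → S) :
    pairProd F (insert v Y) x =
      (∏ y ∈ Y, ENNReal.ofReal (F s(x v, x y))) * pairProd F Y x := by
  have h : pairEdges (insert v Y) = Y.image (fun u => s(v, u)) ∪ pairEdges Y := by
    ext p
    induction p with | _ a b => ?_
    simp only [Finset.mem_union, mk_mem_pairEdges, Finset.mem_image, Sym2.eq_iff]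
    grind
  rw [pairProd, h, Finset.prod_union, Finset.prod_image]
  · simp [pairProd]
  · intro a _ b _ hab
    grind [Sym2.eq_iff]
  · rw [Finset.disjoint_left]
    intro p hp
    obtain ⟨u, _, rfl⟩ := Finset.mem_image.1 hp
    rw [mk_mem_pairEdges]
    exact fun h => hv h.1

theorem pairProd_singleton (F : Sym2 S → ℝ) (v : ι) (x : ι → S) : pairProd F {v} x = 1 := by
  rw [← insert_empty_eq, pairProd_insert F (Finset.notMem_empty v)]
  simp [pairProd, pairEdges]

theorem pairProd_union_le {F : Sym2 S → ℝ} (hF1 : ∀ p, F p ≤ 1) {Y T : Finset ι}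
    (hYT : Disjoint Y T) (x : ι → S) :
    pairProd F (Y ∪ T) x ≤ pairProd F Y x * pairProd F T x := by
  have hd : Disjoint (pairEdges Y) (pairEdges T) := by
    rw [Finset.disjoint_left] at hYT ⊢
    intro p
    induction p with | _ a b => ?_
    simp only [mk_mem_pairEdges]
    grind
  rw [pairProd, pairProd, pairProd, ← Finset.prod_union hd]
  refine Finset.prod_le_prod_of_subset_of_le_one' ?_ ?_
  · intro p
    induction p with | _ a b => ?_
    simp only [Finset.mem_union, mk_mem_pairEdges]
    grind
  · intro p _ _
    exact ENNReal.ofReal_le_one.2 (hF1 _)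

theorem rootedAbs_insert_le {F : Sym2 S → ℝ} (hF0 : ∀ p, 0 ≤ F p) (hF1 : ∀ p, F p ≤ 1)
    {Y X : Finset ι} {v : ι} (hvY : v ∉ Y) (hvX : v ∉ X) (hYX : Disjoint Y X) (x : ι → S) :
    rootedAbs F (insert v Y) X x ≤ (∏ y ∈ Y, ENNReal.ofReal (F s(x v, x y))) *
      ∑ T ∈ X.powerset, starProd F T (x v) x * rootedAbs F (Y ∪ T) (X \ T) x := by
  rw [rootedAbs, rootedSum_insert _ hvY hvX hYX, abs_mul, ENNReal.ofReal_mul (abs_nonneg _)]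
  refine mul_le_mul' (le_of_eq ?_) ?_
  · rw [Finset.abs_prod, ENNReal.ofReal_prod_of_nonneg fun _ _ => abs_nonneg _]
    refine Finset.prod_congr rfl fun y _ => ?_
    simp [abs_of_nonneg (hF0 _)]
  · refine (ENNReal.ofReal_le_ofReal (Finset.abs_sum_le_sum_abs _ _)).trans (le_of_eq ?_)
    rw [ENNReal.ofReal_sum_of_nonneg fun _ _ => abs_nonneg _]
    refine Finset.sum_congr rfl fun T _ => ?_
    rw [abs_mul, ENNReal.ofReal_mul (abs_nonneg _), rootedAbs, starProd, Finset.abs_prod,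
      ENNReal.ofReal_prod_of_nonneg fun _ _ => abs_nonneg _]
    congr 1
    refine Finset.prod_congr rfl fun t _ => ?_
    rw [abs_sub_comm, abs_of_nonneg (sub_nonneg.2 (hF1 _)), Sym2.map_mk]

variable [MeasurableSpace S]

theorem measurable_pairProd {F : Sym2 S → ℝ} (hFm : Measurable fun p : S × S => F s(p.1, p.2))
    (Y : Finset ι) : Measurable (pairProd F Y : (ι → S) → ℝ≥0∞) :=
  Finset.measurable_fun_prod _ fun e _ => (measurable_edge hFm e).ennreal_ofReal

theorem measurable_rootedAbs {F : Sym2 S → ℝ} (hFm : Measurable fun p : S × S => F s(p.1, p.2))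
    (Y X : Finset ι) : Measurable (rootedAbs F Y X : (ι → S) → ℝ≥0∞) := by
  refine Measurable.ennreal_ofReal (Measurable.abs ?_)
  refine Finset.measurable_fun_sum _ fun E _ => ?_
  split_ifs
  · exact Finset.measurable_fun_prod _ fun e _ => (measurable_edge hFm e).sub_const 1
  · exact measurable_const

/-- The integrated weight of `k` mutually interacting neighbours of a point `a`. -/
def vertexInt (F : Sym2 S → ℝ) (ν : Measure S) (k : ℕ) (a : S) : ℝ≥0∞ :=
  ∫⁻ y : Fin k → S, starProd F Finset.univ a y * pairProd F Finset.univ y ∂Measure.pi fun _ => ν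

theorem lmarginal_starProd_mul_pairProd {F : Sym2 S → ℝ}
    (hFm : Measurable fun p : S × S => F s(p.1, p.2)) (ν : Measure S) [SigmaFinite ν]
    {T : Finset ι} {v : ι} (hv : v ∉ T) (x : ι → S) :
    lmarginal (fun _ => ν) T (fun x => starProd F T (x v) x * pairProd F T x) x =
      vertexInt F ν T.card (x v) := by
  obtain ⟨e, he, hT⟩ := exists_injective_image_eq T
  have hev : ∀ i, e i ≠ v := fun i h =>
    hv (h ▸ hT ▸ Finset.mem_image_of_mem e (Finset.mem_univ i))
  rw [vertexInt, ← lmarginal_image_univ ν e he v hev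
    (fun a y => starProd F Finset.univ a y * pairProd F Finset.univ y)
    (fun a => (measurable_starProd hFm _ measurable_const).mul (measurable_pairProd hFm _)), hT]
  congr 1
  funext x'
  conv_lhs => rw [← hT]
  rw [pairProd_image F e he, starProd, Finset.prod_image he.injOn]
  rfl

theorem lmarginal_rootedAbs_insert_le {F : Sym2 S → ℝ} (hF0 : ∀ p, 0 ≤ F p)
    (hF1 : ∀ p, F p ≤ 1) (hFm : Measurable fun p : S × S => F s(p.1, p.2)) (ν : Measure S)
    [SigmaFinite ν] {Y X : Finset ι} {v : ι} (hvY : v ∉ Y) (hvX : v ∉ X) (hYX : Disjoint Y X)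
    (x : ι → S) :
    lmarginal (fun _ => ν) X (rootedAbs F (insert v Y) X) x ≤
      (∏ y ∈ Y, ENNReal.ofReal (F s(x v, x y))) * ∑ T ∈ X.powerset,
        lmarginal (fun _ => ν) T (fun x => starProd F T (x v) x *
          lmarginal (fun _ => ν) (X \ T) (rootedAbs F (Y ∪ T) (X \ T)) x) x := by
  have hm : ∀ T, Measurable fun x : ι → S =>
      starProd F T (x v) x * rootedAbs F (Y ∪ T) (X \ T) x := fun T =>
    (measurable_starProd hFm T (measurable_pi_apply v)).mul (measurable_rootedAbs hFm _ _)
  refine (lmarginal_mono (fun x' => rootedAbs_insert_le hF0 hF1 hvY hvX hYX x') x).trans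
    (le_of_eq ?_)
  rw [lmarginal_mul_of_forall_eq _ X _ _ (Finset.measurable_fun_sum _ fun T _ => hm T) x,
    lmarginal_finset_sum _ _ _ _ hm]
  · congr 1
    refine Finset.sum_congr rfl fun T hT => ?_
    rw [Finset.mem_powerset] at hT
    conv_lhs => rw [← Finset.union_sdiff_of_subset hT]
    rw [lmarginal_union _ _ (by simpa [Finset.union_sdiff_of_subset hT] using hm T)
      Finset.disjoint_sdiff, Finset.union_sdiff_of_subset hT]
    congr 1
    funext x'
    refine lmarginal_mul_of_forall_eq _ _ (fun x => starProd F T (x v) x) _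
      (measurable_rootedAbs hFm _ _) x' ?_
    intro x'' h
    refine Finset.prod_congr rfl fun t ht => ?_
    rw [h v (by grind), h t (by grind)]
  · intro x' h
    rw [Finset.disjoint_left] at hYX
    refine Finset.prod_congr rfl fun y hy => ?_
    rw [h v hvX, h y (hYX hy)]

end RootedBound

section ClusterBound

variable {ι : Type*} {S : Type*} [MeasurableSpace S]

/-- The ratio `(n - k)! / n!`. -/
def factRatio (n k : ℕ) : ℝ≥0∞ := ((n - k).factorial : ℝ≥0∞) / (n.factorial : ℝ≥0∞)

theorem factorial_ne_zero_ennreal (n : ℕ) : (n.factorial : ℝ≥0∞) ≠ 0 :=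
  Nat.cast_ne_zero.2 n.factorial_ne_zero

theorem factRatio_add {n s j : ℕ} :
    factRatio n (s + j) = factRatio n s * factRatio (n - s) j := by
  rw [factRatio, factRatio, factRatio, Nat.sub_sub]
  simp only [div_eq_mul_inv]
  rw [mul_comm ((n - s).factorial : ℝ≥0∞), mul_assoc,
    mul_comm _ (((n - s).factorial : ℝ≥0∞)⁻¹), ← mul_assoc ((n - s).factorial : ℝ≥0∞),
    ENNReal.mul_inv_cancel (factorial_ne_zero_ennreal _) (natCast_ne_top _), one_mul, mul_comm]

theorem choose_mul_factRatio {n k : ℕ} (hk : k ≤ n) :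
    (n.choose k : ℝ≥0∞) * factRatio n k = (k.factorial : ℝ≥0∞)⁻¹ := by
  have h := Nat.choose_mul_factorial_mul_factorial hk
  have h' : (n.choose k : ℝ≥0∞) * (n - k).factorial * k.factorial = n.factorial := by
    exact_mod_cast (by rw [← h]; ring : n.choose k * (n - k).factorial * k.factorial = n.factorial)
  refine ENNReal.eq_inv_of_mul_eq_one_left ?_
  rw [factRatio, ← mul_div_assoc, div_eq_mul_inv, mul_right_comm, h']
  exact ENNReal.mul_inv_cancel (factorial_ne_zero_ennreal _) (natCast_ne_top _)

theorem sum_powerset_factRatio (U : Finset ι) (f : ℕ → ℝ≥0∞) :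
    ∑ X ∈ U.powerset, factRatio U.card X.card * f X.card =
      ∑ k ∈ Finset.range (U.card + 1), f k / (k.factorial : ℝ≥0∞) := by
  rw [Finset.sum_powerset_apply_card fun k => factRatio U.card k * f k]
  refine Finset.sum_congr rfl fun k hk => ?_
  rw [nsmul_eq_mul, ← mul_assoc,
    choose_mul_factRatio (Nat.lt_succ_iff.1 (Finset.mem_range.1 hk)), mul_comm, div_eq_mul_inv]

variable [DecidableEq ι]

/-- Summation over `T ⊆ X ⊆ U` in terms of `T` and `X \ T`. -/
theorem sum_powerset_powerset (U : Finset ι) (f : Finset ι → Finset ι → ℝ≥0∞) :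
    ∑ X ∈ U.powerset, ∑ T ∈ X.powerset, f T (X \ T) =
      ∑ T ∈ U.powerset, ∑ X ∈ (U \ T).powerset, f T X := by
  rw [Finset.sum_sigma', Finset.sum_sigma']
  refine Finset.sum_nbij' (fun q => ⟨q.2, q.1 \ q.2⟩) (fun q => ⟨q.1 ∪ q.2, q.1⟩) ?_ ?_ ?_ ?_ ?_
  · rintro ⟨X, T⟩ h
    simp only [Finset.mem_sigma, Finset.mem_powerset] at h ⊢
    grind
  · rintro ⟨X, T⟩ h
    simp only [Finset.mem_sigma, Finset.mem_powerset] at h ⊢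
    grind
  · rintro ⟨X, T⟩ h
    simp only [Finset.mem_sigma, Finset.mem_powerset] at h
    simp [Finset.union_sdiff_of_subset h.2]
  · rintro ⟨X, T⟩ h
    simp only [Finset.mem_sigma, Finset.mem_powerset] at h
    have : (X ∪ T) \ X = T := by grind
    simp [this]
  · intros; rfl

/-- Rooted graph sums are bounded by `μ ^ |Y|` times the product of the pair weights of the
roots, by induction along the Kirkwood-Salsburg recursion. -/
theorem sum_lmarginal_rootedAbs_le {F : Sym2 S → ℝ} (hF0 : ∀ p, 0 ≤ F p)
    (hF1 : ∀ p, F p ≤ 1) (hFm : Measurable fun p : S × S => F s(p.1, p.2)) (ν : Measure S)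
    [SigmaFinite ν] (z μ : ℝ≥0∞)
    (hz : ∀ a K, z * ∑ k ∈ Finset.range (K + 1),
      μ ^ k * vertexInt F ν k a / (k.factorial : ℝ≥0∞) ≤ μ)
    (Y U : Finset ι) (hYU : Disjoint Y U) (x : ι → S) :
    ∑ X ∈ U.powerset, factRatio U.card X.card *
        (z ^ (Y.card + X.card) * lmarginal (fun _ => ν) X (rootedAbs F Y X) x) ≤
      μ ^ Y.card * pairProd F Y x := by
  induction hn : Y.card + U.card generalizing Y U x with
  | zero =>
    have hY : Y = ∅ := by rw [← Finset.card_eq_zero]; omega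
    have hU : U = ∅ := by rw [← Finset.card_eq_zero]; omega
    subst hY hU
    simp [factRatio, rootedAbs, rootedSum_empty_left, pairProd, pairEdges]
  | succ n ih =>
    obtain rfl | ⟨v, hv⟩ := Y.eq_empty_or_nonempty
    · rw [Finset.sum_eq_single ∅]
      · simp only [factRatio, Finset.card_empty, lmarginal_empty, rootedAbs, rootedSum_empty_left]
        simp [pairProd, pairEdges,
          ENNReal.div_self (factorial_ne_zero_ennreal U.card) (natCast_ne_top _)]
      · intro X _ hX
        have : (rootedAbs F ∅ X : (ι → S) → ℝ≥0∞) = fun _ => 0 := by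
          funext x
          simp [rootedAbs, rootedSum_empty_left, hX]
        simp [this, lmarginal]
      · simp
    · obtain ⟨Y, hvY, rfl⟩ : ∃ Y', v ∉ Y' ∧ insert v Y' = Y :=
        ⟨Y.erase v, Finset.notMem_erase _ _, Finset.insert_erase hv⟩
      obtain ⟨hvU, hYU⟩ := Finset.disjoint_insert_left.1 hYU
      rw [Finset.card_insert_of_notMem hvY] at hn ⊢
      set A : ℝ≥0∞ := ∏ y ∈ Y, ENNReal.ofReal (F s(x v, x y)) with hA
      set L : Finset ι → ((ι → S) → ℝ≥0∞) → (ι → S) → ℝ≥0∞ := lmarginal (fun _ => ν) with hL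
      have hLm : ∀ T X, Measurable (L X (rootedAbs F (Y ∪ T) X)) := fun T X =>
        (measurable_rootedAbs hFm _ _).lmarginal _
      have hsm : ∀ T, Measurable fun x : ι → S => starProd F T (x v) x := fun T =>
        measurable_starProd hFm T (measurable_pi_apply v)
      calc ∑ X ∈ U.powerset, factRatio U.card X.card *
            (z ^ (Y.card + 1 + X.card) * L X (rootedAbs F (insert v Y) X) x)
          ≤ ∑ X ∈ U.powerset, ∑ T ∈ X.powerset,
              z * A * (factRatio U.card T.card *
                (factRatio (U \ T).card (X \ T).card * (z ^ ((Y ∪ T).card + (X \ T).card) *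
                  L T (fun x => starProd F T (x v) x *
                    L (X \ T) (rootedAbs F (Y ∪ T) (X \ T)) x) x))) := by
            refine Finset.sum_le_sum fun X hX => ?_
            rw [Finset.mem_powerset] at hX
            refine (mul_le_mul_right (mul_le_mul_right (lmarginal_rootedAbs_insert_le hF0 hF1 hFm ν
              hvY (fun h => hvU (hX h)) (Finset.disjoint_of_subset_right hX hYU) x) _) _).trans ?_
            rw [← hL, ← hA, Finset.mul_sum, Finset.mul_sum, Finset.mul_sum]
            refine Finset.sum_le_sum fun T hT => le_of_eq ?_
            rw [Finset.mem_powerset] at hT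
            have h1 : (X \ T).card + T.card = X.card := Finset.card_sdiff_add_card_eq_card hT
            have h2 : (U \ T).card = U.card - T.card := Finset.card_sdiff_of_subset (hT.trans hX)
            have h3 : (Y ∪ T).card = Y.card + T.card := Finset.card_union_of_disjoint
              (Finset.disjoint_of_subset_right (hT.trans hX) hYU)
            rw [h2, h3, ← h1, add_comm _ T.card, factRatio_add]
            ring
        _ = ∑ T ∈ U.powerset, ∑ X ∈ (U \ T).powerset,
              z * A * (factRatio U.card T.card *
                (factRatio (U \ T).card X.card * (z ^ ((Y ∪ T).card + X.card) *
                  L T (fun x => starProd F T (x v) x * L X (rootedAbs F (Y ∪ T) X) x) x))) :=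
            sum_powerset_powerset U fun T X => z * A * (factRatio U.card T.card *
                (factRatio (U \ T).card X.card * (z ^ ((Y ∪ T).card + X.card) *
                  L T (fun x => starProd F T (x v) x * L X (rootedAbs F (Y ∪ T) X) x) x)))
        _ ≤ ∑ T ∈ U.powerset, z * A * (factRatio U.card T.card *
              (μ ^ Y.card * pairProd F Y x * (μ ^ T.card * vertexInt F ν T.card (x v)))) := by
            refine Finset.sum_le_sum fun T hT => ?_
            rw [Finset.mem_powerset] at hT
            have hYT : Disjoint Y T := Finset.disjoint_of_subset_right hT hYU
            have hcard : (Y ∪ T).card + (U \ T).card = n := by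
              have h2 := Finset.card_sdiff_add_card_eq_card hT
              have h3 := Finset.card_union_of_disjoint hYT
              omega
            have hdisj : Disjoint (Y ∪ T) (U \ T) := by
              rw [Finset.disjoint_left] at hYU ⊢
              grind
            rw [← Finset.mul_sum, ← Finset.mul_sum]
            refine mul_le_mul_right (mul_le_mul_right ?_ _) _
            calc ∑ X ∈ (U \ T).powerset,
                  (factRatio (U \ T).card X.card * (z ^ ((Y ∪ T).card + X.card) *
                    L T (fun x => starProd F T (x v) x * L X (rootedAbs F (Y ∪ T) X) x) x))
                = L T (fun x => ∑ X ∈ (U \ T).powerset,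
                    (factRatio (U \ T).card X.card * z ^ ((Y ∪ T).card + X.card)) *
                      (starProd F T (x v) x * L X (rootedAbs F (Y ∪ T) X) x)) x := by
                  rw [hL, lmarginal_finset_sum]
                  · refine Finset.sum_congr rfl fun X _ => ?_
                    rw [lmarginal_mul_of_forall_eq _ _
                      (fun _ => factRatio (U \ T).card X.card * z ^ ((Y ∪ T).card + X.card)) _
                      (show Measurable fun x => starProd F T (x v) x *
                        lmarginal (fun _ => ν) X (rootedAbs F (Y ∪ T) X) x from
                        (hsm T).mul (hLm T X)) _ (fun _ _ => rfl), mul_assoc]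
                  · exact fun X => ((hsm T).mul (hLm T X)).const_mul _
              _ ≤ L T (fun x => (μ ^ Y.card * pairProd F Y x) *
                    (μ ^ T.card * (starProd F T (x v) x * pairProd F T x))) x := by
                  refine lmarginal_mono (fun x' => ?_) x
                  have hi := ih (Y ∪ T) (U \ T) hdisj x' hcard
                  calc ∑ X ∈ (U \ T).powerset,
                        (factRatio (U \ T).card X.card * z ^ ((Y ∪ T).card + X.card)) *
                          (starProd F T (x' v) x' * L X (rootedAbs F (Y ∪ T) X) x')
                      = starProd F T (x' v) x' * ∑ X ∈ (U \ T).powerset,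
                          factRatio (U \ T).card X.card *
                            (z ^ ((Y ∪ T).card + X.card) * L X (rootedAbs F (Y ∪ T) X) x') := by
                        rw [Finset.mul_sum]
                        exact Finset.sum_congr rfl fun X _ => by ring
                    _ ≤ starProd F T (x' v) x' *
                          (μ ^ (Y ∪ T).card * (pairProd F Y x' * pairProd F T x')) :=
                        mul_le_mul_right (hi.trans
                          (mul_le_mul_right (pairProd_union_le hF1 hYT x') _)) _
                    _ = _ := by
                        rw [Finset.card_union_of_disjoint hYT]
                        ring
              _ = μ ^ Y.card * pairProd F Y x * (μ ^ T.card * vertexInt F ν T.card (x v)) := by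
                  have hm : Measurable fun x : ι → S => starProd F T (x v) x * pairProd F T x :=
                    (hsm T).mul (measurable_pairProd hFm T)
                  rw [hL, lmarginal_mul_of_forall_eq _ _
                    (fun x => μ ^ Y.card * pairProd F Y x) _ (hm.const_mul _),
                    lmarginal_mul_of_forall_eq _ _ (fun _ => μ ^ T.card) _ hm _ (fun _ _ => rfl),
                    lmarginal_starProd_mul_pairProd hFm ν (fun h => hvU (hT h))]
                  intro x' h
                  rw [Finset.disjoint_left] at hYT
                  simp only [pairProd]
                  congr 1
                  refine Finset.prod_congr rfl fun e he => ?_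
                  induction e with | _ a b => ?_
                  have := mk_mem_pairEdges.1 he
                  rw [Sym2.map_mk, Sym2.map_mk, h a (hYT this.1), h b (hYT this.2.1)]
        _ = (z * ∑ k ∈ Finset.range (U.card + 1),
              μ ^ k * vertexInt F ν k (x v) / (k.factorial : ℝ≥0∞)) *
              (μ ^ Y.card * (A * pairProd F Y x)) := by
            rw [← sum_powerset_factRatio U fun k => μ ^ k * vertexInt F ν k (x v),
              Finset.mul_sum, Finset.sum_mul]
            exact Finset.sum_congr rfl fun T _ => by ring
        _ ≤ μ * (μ ^ Y.card * (A * pairProd F Y x)) := mul_le_mul_left (hz _ _) _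
        _ = μ ^ (Y.card + 1) * pairProd F (insert v Y) x := by
            rw [pairProd_insert F hvY]
            ring

theorem lmarginal_rootedAbs_singleton {F : Sym2 S → ℝ}
    (hFm : Measurable fun p : S × S => F s(p.1, p.2)) (ν : Measure S) [SigmaFinite ν]
    {X : Finset ι} {v : ι} (hv : v ∉ X) (x : ι → S) :
    lmarginal (fun _ => ν) X (rootedAbs F {v} X) x =
      ∫⁻ y : Fin X.card → S, rootedAbs F {0} (Finset.univ.erase 0) (Fin.cons (x v) y : _ → S)
        ∂Measure.pi fun _ => ν := by
  obtain ⟨e, he, hX⟩ := exists_injective_image_eq X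
  have hev : ∀ i, e i ≠ v := fun i h =>
    hv (h ▸ hX ▸ Finset.mem_image_of_mem e (Finset.mem_univ i))
  rw [← lmarginal_image_univ ν e he v hev
    (fun a y => rootedAbs F {0} (Finset.univ.erase 0) (Fin.cons a y : Fin (X.card + 1) → S)), hX]
  · congr 1
    funext x'
    have he' : Function.Injective (Fin.cons v e : Fin (X.card + 1) → ι) :=
      Fin.cons_injective_iff.2 ⟨fun ⟨i, hi⟩ => hev i hi, he⟩
    have h0 : ({v} : Finset ι) = ({0} : Finset (Fin (X.card + 1))).image (Fin.cons v e) := by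
      simp
    have h1 : X = (Finset.univ.erase (0 : Fin (X.card + 1))).image (Fin.cons v e) := by
      conv_lhs => rw [← hX]
      ext a
      simp [Fin.exists_fin_succ]
    have h2 : (Fin.cons (x' v) (x' ∘ e) : Fin (X.card + 1) → S) = x' ∘ Fin.cons v e := by
      funext i
      refine Fin.cases ?_ (fun i => ?_) i <;> simp
    calc rootedAbs F {v} X x'
        = rootedAbs F (({0} : Finset (Fin (X.card + 1))).image (Fin.cons v e))
            ((Finset.univ.erase 0).image (Fin.cons v e)) x' := by rw [← h0, ← h1]
      _ = _ := by
        rw [rootedAbs, rootedSum_image _ he' _ _ _ (by simp), rootedAbs, h2]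
        simp [Sym2.map_map]
  · exact fun a => (measurable_rootedAbs hFm _ _).comp
      (measurable_pi_iff.2 fun i => by
        refine Fin.cases ?_ (fun i => ?_) i
        · simp
        · simpa using measurable_pi_apply i)

theorem sum_lintegral_rootedAbs_cons_le {F : Sym2 S → ℝ} (hF0 : ∀ p, 0 ≤ F p)
    (hF1 : ∀ p, F p ≤ 1) (hFm : Measurable fun p : S × S => F s(p.1, p.2)) (ν : Measure S)
    [SigmaFinite ν] (z μ : ℝ≥0∞)
    (hz : ∀ a K, z * ∑ k ∈ Finset.range (K + 1),
      μ ^ k * vertexInt F ν k a / (k.factorial : ℝ≥0∞) ≤ μ)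
    (a : S) (K : ℕ) :
    ∑ k ∈ Finset.range (K + 1), z ^ (k + 1) *
      (∫⁻ y : Fin k → S, rootedAbs F {0} (Finset.univ.erase 0) (Fin.cons a y : _ → S)
        ∂Measure.pi fun _ => ν) / (k.factorial : ℝ≥0∞) ≤ μ := by
  have h := sum_lmarginal_rootedAbs_le hF0 hF1 hFm ν z μ hz ({0} : Finset ℕ) (Finset.Icc 1 K)
    (by simp) (fun _ => a)
  rw [Finset.card_singleton, pow_one] at h
  have hK : (Finset.Icc 1 K).card = K := by simp
  rw [← hK, ← sum_powerset_factRatio (Finset.Icc 1 K) fun k => z ^ (k + 1) *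
      (∫⁻ y : Fin k → S, rootedAbs F {0} (Finset.univ.erase 0) (Fin.cons a y : _ → S)
        ∂Measure.pi fun _ => ν)]
  refine le_trans (le_of_eq (Finset.sum_congr rfl fun X hX => ?_))
    (h.trans (le_of_eq (by rw [pairProd_singleton, mul_one])))
  rw [lmarginal_rootedAbs_singleton hFm ν (v := 0) (by grind), add_comm 1]

end ClusterBound

section PairPotential

variable {d : ℕ} {β : ℝ} {φ : (Fin d → ℝ) → ℝ≥0∞}

theorem pairW_nonneg (x y : Fin d → ℝ) : 0 ≤ pairW β φ x y := by
  unfold pairW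
  split_ifs
  · exact le_rfl
  · exact (Real.exp_pos _).le

theorem pairW_le_one (hβ : 0 < β) (x y : Fin d → ℝ) : pairW β φ x y ≤ 1 := by
  unfold pairW
  split_ifs
  · exact zero_le_one
  · exact Real.exp_le_one_iff.2 (neg_nonpos.2 (mul_nonneg hβ.le toReal_nonneg))

theorem pairW_comm (hφeven : ∀ v, φ (-v) = φ v) (x y : Fin d → ℝ) :
    pairW β φ x y = pairW β φ y x := by
  rw [pairW, pairW, ← neg_sub y x, hφeven]

theorem measurable_pairW (hφm : Measurable φ) :
    Measurable fun p : (Fin d → ℝ) × (Fin d → ℝ) => pairW β φ p.1 p.2 := by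
  have h : Measurable fun p : (Fin d → ℝ) × (Fin d → ℝ) => φ (p.1 - p.2) :=
    hφm.comp (measurable_fst.sub measurable_snd)
  exact Measurable.ite (h (measurableSet_singleton ∞)) measurable_const
    (Real.measurable_exp.comp (h.ennreal_toReal.const_mul β).neg)

/-- The pair weight as a function of unordered pairs. -/
def pairWSym (β : ℝ) (φ : (Fin d → ℝ) → ℝ≥0∞) (hφeven : ∀ v, φ (-v) = φ v) :
    Sym2 (Fin d → ℝ) → ℝ :=
  Sym2.lift ⟨pairW β φ, pairW_comm hφeven⟩

theorem starProd_mul_pairProd_eq (hβ : 0 < β) (hφeven : ∀ v, φ (-v) = φ v) (k : ℕ)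
    (a : Fin d → ℝ) (y : Fin k → Fin d → ℝ) :
    starProd (pairWSym β φ hφeven) Finset.univ a y * pairProd (pairWSym β φ hφeven) Finset.univ y =
      ENNReal.ofReal (phiVertex (pairW β φ) k a y) := by
  have hstar : ∀ i ∈ (Finset.univ : Finset (Fin k)), 0 ≤ 1 - pairW β φ a (y i) :=
    fun i _ => sub_nonneg.2 (pairW_le_one hβ _ _)
  have hpair : ∀ e : Sym2 (Fin d → ℝ), 0 ≤ pairWSym β φ hφeven e := fun e => by
    induction e with | _ a b => exact pairW_nonneg a b
  rw [phiVertex, ENNReal.ofReal_mul (Finset.prod_nonneg hstar),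
    ENNReal.ofReal_prod_of_nonneg hstar, pairProd, ← ENNReal.ofReal_prod_of_nonneg
      fun e _ => hpair _, ← prod_lt_pairs_eq_prod (pairEdges Finset.univ)
      (fun e he => (Finset.mem_filter.1 he).2)
      fun e => pairWSym β φ hφeven (e.map y)]
  congr 2
  refine Finset.prod_congr ?_ fun _ _ => rfl
  ext p
  simp only [Finset.mem_filter, Finset.mem_univ, true_and, mk_mem_pairEdges]
  exact ⟨fun h => h.1, fun h => ⟨h, h.ne⟩⟩

theorem vertexInt_eq_gCoef (hβ : 0 < β) (hφeven : ∀ v, φ (-v) = φ v) (k : ℕ)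
    (a : Fin d → ℝ) : vertexInt (pairWSym β φ hφeven) volume k a = gCoef β φ k := by
  rw [vertexInt, gCoef, ← volume_pi]
  simp only [starProd_mul_pairProd_eq hβ hφeven]
  rw [← lintegral_sub_right_eq_self
    (fun y => ENNReal.ofReal (phiVertex (pairW β φ) k 0 y)) fun _ : Fin k => a]
  refine lintegral_congr fun y => ?_
  congr 1
  simp [phiVertex, pairW]

theorem gCoef_zero : gCoef β φ 0 = 1 := by
  simp [gCoef, phiVertex, volume_pi]

theorem mul_sum_vertexInt_le (hβ : 0 < β) (hφeven : ∀ v, φ (-v) = φ v) {z μ : ℝ≥0∞}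
    (hz : z ≤ μ / vertexSum β φ μ) (a : Fin d → ℝ) (K : ℕ) :
    z * ∑ k ∈ Finset.range (K + 1),
      μ ^ k * vertexInt (pairWSym β φ hφeven) volume k a / (k.factorial : ℝ≥0∞) ≤ μ := by
  refine le_trans (mul_le_mul_right ?_ z) (ENNReal.mul_le_of_le_div hz)
  simp only [vertexInt_eq_gCoef hβ]
  rw [Finset.sum_range_succ', add_comm, vertexSum]
  refine add_le_add (by simp [gCoef_zero]) ?_
  refine le_trans (le_of_eq ?_) (ENNReal.sum_le_tsum (Finset.range K))
  exact Finset.sum_congr rfl fun k _ => by rw [mul_comm (μ ^ (k + 1))]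

end PairPotential

theorem measurable_cons {S : Type*} [MeasurableSpace S] (n : ℕ) :
    Measurable fun p : S × (Fin n → S) => (Fin.cons p.1 p.2 : Fin (n + 1) → S) := by
  refine measurable_pi_iff.2 fun i => ?_
  refine Fin.cases ?_ (fun i => ?_) i
  · simpa using measurable_fst
  · simpa [Function.comp_def] using
      (measurable_pi_apply i).comp (measurable_snd (α := S) (β := Fin n → S))

/-- Bound an integral over `Λ^{n+1}` by releasing all coordinates but the first. -/
theorem setLIntegral_univ_pi_succ_le {d n : ℕ} {Λ : Set (Fin d → ℝ)}
    {f : (Fin (n + 1) → Fin d → ℝ) → ℝ≥0∞} (hf : Measurable f) :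
    ∫⁻ x in Set.univ.pi (fun _ : Fin (n + 1) => Λ), f x ≤
      ∫⁻ t in Λ, ∫⁻ y : Fin n → Fin d → ℝ, f (Fin.cons t y) := by
  let e := MeasurableEquiv.piFinSuccAbove (fun _ : Fin (n + 1) => Fin d → ℝ) 0
  have he := volume_preserving_piFinSuccAbove (fun _ : Fin (n + 1) => Fin d → ℝ) 0
  have hsub : Set.univ.pi (fun _ : Fin (n + 1) => Λ) ⊆ e ⁻¹' (Λ ×ˢ Set.univ) := by
    intro x hx
    exact ⟨hx 0 (Set.mem_univ _), Set.mem_univ _⟩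
  refine (lintegral_mono_set hsub).trans (le_of_eq ?_)
  have h := he.setLIntegral_comp_preimage_emb e.measurableEmbedding
    (fun p => f (Fin.cons p.1 p.2)) (Λ ×ˢ Set.univ)
  calc ∫⁻ x in e ⁻¹' (Λ ×ˢ Set.univ), f x
      = ∫⁻ x in e ⁻¹' (Λ ×ˢ Set.univ), f (Fin.cons (e x).1 (e x).2) := by
        refine lintegral_congr fun x => ?_
        congr 1
        exact (Fin.cons_self_tail x).symm
    _ = _ := h
    _ = _ := by
        rw [Measure.volume_eq_prod, ← Measure.prod_restrict, Measure.restrict_univ,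
          lintegral_prod (fun p => f (Fin.cons p.1 p.2)) (hf.comp (measurable_cons n)).aemeasurable]

theorem statement0 {d : ℕ} (hd : 1 ≤ d) (β : ℝ) (hβ : 0 < β)
    (φ : (Fin d → ℝ) → ℝ≥0∞) (hφm : Measurable φ) (hφeven : ∀ v, φ (-v) = φ v)
    (hT : ∫⁻ v : Fin d → ℝ, ENNReal.ofReal (1 - pairW β φ v 0) < ∞)
    (z : ℂ) (μ : ℝ) (hμ : 0 < μ)
    (hz : ENNReal.ofReal ‖z‖ ≤ ENNReal.ofReal μ / vertexSum β φ (ENNReal.ofReal μ))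
    (Λ : Set (Fin d → ℝ)) (hΛ : MeasurableSet Λ) (hΛfin : volume Λ < ∞) :
    (∑' n : ℕ, ENNReal.ofReal (‖z‖ ^ (n + 1) / (n + 1).factorial) *
        ∫⁻ x in Set.univ.pi (fun _ : Fin (n + 1) => Λ),
          ENNReal.ofReal |omegaT (pairW β φ) (n + 1) x|
      ≤ ENNReal.ofReal μ * volume Λ) ∧
    Summable (fun n : ℕ => z ^ (n + 1) / ((n + 1).factorial : ℂ) *
        ((∫ x in Set.univ.pi (fun _ : Fin (n + 1) => Λ),
          omegaT (pairW β φ) (n + 1) x : ℝ) : ℂ)) ∧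
    ‖∑' n : ℕ, z ^ (n + 1) / ((n + 1).factorial : ℂ) *
        ((∫ x in Set.univ.pi (fun _ : Fin (n + 1) => Λ),
          omegaT (pairW β φ) (n + 1) x : ℝ) : ℂ)‖
      ≤ μ * (volume Λ).toReal := by
  set F := pairWSym β φ hφeven
  have hF0 : ∀ p, 0 ≤ F p := fun p => by
    induction p with | _ a b => exact pairW_nonneg a b
  have hF1 : ∀ p, F p ≤ 1 := fun p => by
    induction p with | _ a b => exact pairW_le_one hβ a b
  have hFm : Measurable fun p : (Fin d → ℝ) × (Fin d → ℝ) => F s(p.1, p.2) :=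
    measurable_pairW hφm
  have homega : ∀ n (x : Fin (n + 1) → Fin d → ℝ),
      ENNReal.ofReal |omegaT (pairW β φ) (n + 1) x| =
        rootedAbs F {0} (Finset.univ.erase 0) x := fun n x => by
    rw [omegaT_eq_rootedSum (pairW β φ) (fun p => F p - 1) (fun _ _ => rfl), rootedAbs]
  have hRm : ∀ n, Measurable (rootedAbs F {0} (Finset.univ.erase 0) :
      (Fin (n + 1) → Fin d → ℝ) → ℝ≥0∞) := fun n => measurable_rootedAbs hFm _ _
  have hmain : ∑' n : ℕ, ENNReal.ofReal (‖z‖ ^ (n + 1) / (n + 1).factorial) *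
        ∫⁻ x in Set.univ.pi (fun _ : Fin (n + 1) => Λ),
          ENNReal.ofReal |omegaT (pairW β φ) (n + 1) x|
      ≤ ENNReal.ofReal μ * volume Λ := by
    refine ENNReal.tsum_le_of_sum_range_le fun N => ?_
    let J : ℕ → (Fin d → ℝ) → ℝ≥0∞ := fun n t => ∫⁻ y : Fin n → Fin d → ℝ,
      rootedAbs F {0} (Finset.univ.erase 0) (Fin.cons t y : Fin (n + 1) → Fin d → ℝ)
    have hJ : ∀ n, Measurable (J n) := fun n =>
      ((hRm n).comp (measurable_cons n)).lintegral_prod_right'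
    calc ∑ n ∈ Finset.range N, ENNReal.ofReal (‖z‖ ^ (n + 1) / (n + 1).factorial) *
          ∫⁻ x in Set.univ.pi (fun _ : Fin (n + 1) => Λ),
            ENNReal.ofReal |omegaT (pairW β φ) (n + 1) x|
        ≤ ∑ n ∈ Finset.range N, ∫⁻ t in Λ,
            ENNReal.ofReal ‖z‖ ^ (n + 1) * J n t / (n.factorial : ℝ≥0∞) := by
          refine Finset.sum_le_sum fun n _ => ?_
          have h1 : ENNReal.ofReal (‖z‖ ^ (n + 1) / (n + 1).factorial) ≤
              ENNReal.ofReal ‖z‖ ^ (n + 1) * (n.factorial : ℝ≥0∞)⁻¹ := by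
            rw [ENNReal.ofReal_div_of_pos (by positivity), ENNReal.ofReal_pow (norm_nonneg z),
              div_eq_mul_inv, ENNReal.ofReal_natCast]
            refine mul_le_mul_right (ENNReal.inv_le_inv.2 ?_) _
            exact_mod_cast Nat.factorial_le n.le_succ
          simp only [homega]
          refine (mul_le_mul' h1 (setLIntegral_univ_pi_succ_le (hRm n))).trans (le_of_eq ?_)
          rw [← lintegral_const_mul _ (hJ n)]
          refine lintegral_congr fun t => ?_
          rw [div_eq_mul_inv, mul_right_comm]
      _ = ∫⁻ t in Λ, ∑ n ∈ Finset.range N,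
            ENNReal.ofReal ‖z‖ ^ (n + 1) * J n t / (n.factorial : ℝ≥0∞) :=
          (lintegral_finsetSum _ fun n _ => ((hJ n).const_mul _).div_const _).symm
      _ ≤ ∫⁻ t in Λ, ENNReal.ofReal μ := by
          refine lintegral_mono fun t => ?_
          refine (Finset.sum_le_sum_of_subset (Finset.range_mono N.le_succ)).trans ?_
          exact sum_lintegral_rootedAbs_cons_le hF0 hF1 hFm volume _ _
            (mul_sum_vertexInt_le hβ hφeven hz) t N
      _ = ENNReal.ofReal μ * volume Λ := by simp
  have hterm : ∀ n : ℕ, ‖z ^ (n + 1) / ((n + 1).factorial : ℂ) *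
      ((∫ x in Set.univ.pi (fun _ : Fin (n + 1) => Λ),
        omegaT (pairW β φ) (n + 1) x : ℝ) : ℂ)‖ₑ ≤
      ENNReal.ofReal (‖z‖ ^ (n + 1) / (n + 1).factorial) *
        ∫⁻ x in Set.univ.pi (fun _ : Fin (n + 1) => Λ),
          ENNReal.ofReal |omegaT (pairW β φ) (n + 1) x| := by
    intro n
    rw [enorm_mul]
    refine mul_le_mul' (le_of_eq ?_) ?_
    · rw [← ofReal_norm, norm_div, norm_pow, Complex.norm_natCast]
    · rw [← ofReal_norm, Complex.norm_real, ofReal_norm]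
      refine (enorm_integral_le_lintegral_enorm _).trans (le_of_eq ?_)
      exact lintegral_congr fun x => by rw [← ofReal_norm, Real.norm_eq_abs]
  have hsum := (ENNReal.tsum_le_tsum hterm).trans hmain
  have hfin : ENNReal.ofReal μ * volume Λ ≠ ∞ := ENNReal.mul_ne_top ofReal_ne_top hΛfin.ne
  refine ⟨hmain, ?_, ?_⟩
  · exact Summable.of_enorm (ne_top_of_le_ne_top hfin hsum)
  · have h := ENNReal.toReal_mono hfin (enorm_tsum_le_tsum_enorm.trans hsum)
    rwa [toReal_enorm, ENNReal.toReal_mul, ENNReal.toReal_ofReal hμ.le] at h
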